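/- For all integers m, s with s ≥ 5, m > 2s and m ≡ 3 (mod 2s), there exists a decentralized linear code of length ℓ = 3·(m − 3)/(2·s) + 3 for parameters (m, s) that is both correct and secure. -/

import Mathlib

namespace SDPicod

/-- Side information set of user `i`: the `s` cyclically consecutive message
indices ending at `i`, i.e. `{i - k : k ∈ Finset.range s}`. -/
def sideInfo (m s : ℕ) (i : ZMod m) : Set (ZMod m) :=
  {j | ∃ k ∈ Finset.range s, j = i - (k : ZMod m)}

/-- A decentralized linear code: every row is encodable by some user, i.e.
its support is contained in that user's side information set. -/
def IsDecentralizedCode (m s : ℕ) {ℓ : ℕ} (G : Fin ℓ → ZMod m → ZMod 2) : Prop :=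
  ∀ t : Fin ℓ, ∃ i : ZMod m, Function.support (G t) ⊆ sideInfo m s i

/-- The set of message indices user `i` can decode: indices `j` outside the
side information set such that the standard basis vector `e j` lies in the
`GF(2)`-span of the rows of `G` together with the basis vectors of the
side information set. -/
def decSet (m s : ℕ) {ℓ : ℕ} (G : Fin ℓ → ZMod m → ZMod 2) (i : ZMod m) :
    Set (ZMod m) :=
  {j | j ∉ sideInfo m s i ∧
    Pi.single j (1 : ZMod 2) ∈ Submodule.span (ZMod 2)
      (Set.range G ∪ {v | ∃ k ∈ sideInfo m s i, v = Pi.single k (1 : ZMod 2)})}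

/-- Correctness: every user can decode at least one new message. -/
def Correct (m s : ℕ) {ℓ : ℕ} (G : Fin ℓ → ZMod m → ZMod 2) : Prop :=
  ∀ i : ZMod m, (decSet m s G i).Nonempty

/-- Security: no user can decode more than one new message. -/
def Secure (m s : ℕ) {ℓ : ℕ} (G : Fin ℓ → ZMod m → ZMod 2) : Prop :=
  ∀ i : ZMod m, (decSet m s G i).Subsingleton

end SDPicod

namespace SDPicod

/-- Membership of message `x` in the side information of user `i`, on representatives
below `m`. -/
def Knows (m s i x : ℕ) : Prop :=
  (x ≤ i ∧ i < x + s) ∨ i + m < x + s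

theorem mem_sideInfo_iff {m s : ℕ} [NeZero m] (hsm : s < m) (i j : ZMod m) :
    j ∈ sideInfo m s i ↔ Knows m s i.val j.val := by
  have hi := i.val_lt
  have hj := j.val_lt
  constructor
  · rintro ⟨k, hk, rfl⟩
    rw [Finset.mem_range] at hk
    have hkv : (k : ZMod m).val = k := ZMod.val_cast_of_lt (hk.trans hsm)
    have h := ZMod.val_add (i - (k : ZMod m)) (k : ZMod m)
    rw [sub_add_cancel, hkv] at h
    rcases lt_or_ge ((i - (k : ZMod m)).val + k) m with hlt | hge
    · rw [Nat.mod_eq_of_lt hlt] at h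
      left; omega
    · rw [Nat.mod_eq_sub_mod hge, Nat.mod_eq_of_lt (by omega)] at h
      right; omega
  · rintro (⟨h1, h2⟩ | h)
    · refine ⟨i.val - j.val, Finset.mem_range.2 (by omega), ?_⟩
      rw [Nat.cast_sub h1, ZMod.natCast_zmod_val, ZMod.natCast_zmod_val, sub_sub_cancel]
    · refine ⟨i.val + m - j.val, Finset.mem_range.2 (by omega), ?_⟩
      rw [Nat.cast_sub (by omega), Nat.cast_add, ZMod.natCast_zmod_val, ZMod.natCast_zmod_val,
        ZMod.natCast_self, add_zero, sub_sub_cancel]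

/-- The indicator vector of a set of representatives. -/
def indicatorRow (m : ℕ) (R : Finset ℕ) (j : ZMod m) : ZMod 2 :=
  if j.val ∈ R then 1 else 0

/-- `F` is a dual vector for the rows `L` and the side information of user `i`. -/
def IsDual (m s : ℕ) (L : List (Finset ℕ)) (i : ℕ) (F : Finset ℕ) : Prop :=
  (∀ x ∈ F, x < m ∧ ¬ Knows m s i x) ∧ ∀ R ∈ L, Even (F ∩ R).card

/-- User `i` knows every message of the row `R` except for `j`. -/
def Exposes (m s i : ℕ) (R : Finset ℕ) (j : ℕ) : Prop :=
  j ∈ R ∧ ¬ Knows m s i j ∧ ∀ x ∈ R, x ≠ j → Knows m s i x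

theorem single_mem_span_of_exposes {m s : ℕ} [NeZero m] (hsm : s < m) {i : ZMod m}
    {R : Finset ℕ} {j : ℕ} (hj : j < m) (h : Exposes m s i.val R j) {S : Set (ZMod m → ZMod 2)}
    (hS : indicatorRow m R ∈ S) :
    Pi.single (j : ZMod m) (1 : ZMod 2) ∈ Submodule.span (ZMod 2)
      (S ∪ {v | ∃ k ∈ sideInfo m s i, v = Pi.single k (1 : ZMod 2)}) := by
  obtain ⟨hjR, hjk, hR⟩ := h
  set W := Submodule.span (ZMod 2)
      (S ∪ {v | ∃ k ∈ sideInfo m s i, v = Pi.single k (1 : ZMod 2)}) with hW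
  have hjv : (j : ZMod m).val = j := ZMod.val_cast_of_lt hj
  have hrow : indicatorRow m R ∈ W := Submodule.subset_span (Or.inl hS)
  have hsum : indicatorRow m R = ∑ k : ZMod m, indicatorRow m R k • Pi.single k (1 : ZMod 2) := by
    ext x
    simp [Finset.sum_apply, Pi.single_apply]
  rw [← Finset.add_sum_erase _ _ (Finset.mem_univ (j : ZMod m))] at hsum
  have h1 : indicatorRow m R (j : ZMod m) = 1 := by simp [indicatorRow, hjv, hjR]
  rw [h1, one_smul] at hsum
  rw [eq_sub_of_add_eq hsum.symm]
  refine W.sub_mem hrow (W.sum_mem fun k hk => ?_)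
  by_cases hkR : k.val ∈ R
  · refine W.smul_mem _ (Submodule.subset_span (Or.inr ⟨k, ?_, rfl⟩))
    rw [mem_sideInfo_iff hsm]
    refine hR _ hkR fun hkj => (Finset.mem_erase.1 hk).1 ?_
    rw [← hkj, ZMod.natCast_zmod_val]
  · simp [indicatorRow, hkR]

theorem single_notMem_span_of_isDual {m s : ℕ} [NeZero m] (hsm : s < m) {i j : ZMod m}
    {L : List (Finset ℕ)} {F : Finset ℕ} (hF : IsDual m s L i.val F) (hj : j.val ∈ F)
    {S : Set (ZMod m → ZMod 2)} (hS : ∀ v ∈ S, v = 0 ∨ ∃ R ∈ L, v = indicatorRow m R) :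
    Pi.single j (1 : ZMod 2) ∉ Submodule.span (ZMod 2)
      (S ∪ {v | ∃ k ∈ sideInfo m s i, v = Pi.single k (1 : ZMod 2)}) := by
  let f : (ZMod m → ZMod 2) →ₗ[ZMod 2] ZMod 2 := ∑ x ∈ F, LinearMap.proj (x : ZMod m)
  have hf : ∀ v, f v = ∑ x ∈ F, v (x : ZMod m) := fun v => by simp [f]
  have hcast : ∀ x ∈ F, (x : ZMod m).val = x := fun x hx => ZMod.val_cast_of_lt (hF.1 x hx).1
  intro hmem
  have hle : Submodule.span (ZMod 2)
      (S ∪ {v | ∃ k ∈ sideInfo m s i, v = Pi.single k (1 : ZMod 2)}) ≤ LinearMap.ker f := by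
    rw [Submodule.span_le]
    rintro v (hv | ⟨k, hk, rfl⟩)
    · rcases hS v hv with rfl | ⟨R, hR, rfl⟩
      · simp
      · rw [SetLike.mem_coe, LinearMap.mem_ker, hf]
        have : ∑ x ∈ F, indicatorRow m R (x : ZMod m) = ((F ∩ R).card : ZMod 2) := by
          rw [Finset.card_eq_sum_ones, Nat.cast_sum, ← Finset.filter_mem_eq_inter,
            Finset.sum_filter]
          refine Finset.sum_congr rfl fun x hx => ?_
          simp [indicatorRow, hcast x hx]
        rw [this, ZMod.natCast_eq_zero_iff_even]
        exact hF.2 R hR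
    · rw [SetLike.mem_coe, LinearMap.mem_ker, hf]
      refine Finset.sum_eq_zero fun x hx => Pi.single_eq_of_ne ?_ _
      rintro rfl
      rw [mem_sideInfo_iff hsm, hcast x hx] at hk
      exact (hF.1 x hx).2 hk
  have h0 := hle hmem
  rw [LinearMap.mem_ker, hf, Finset.sum_eq_single_of_mem _ hj, ZMod.natCast_zmod_val,
    Pi.single_eq_same] at h0
  · exact one_ne_zero h0
  · intro x hx hxj
    refine Pi.single_eq_of_ne ?_ _
    rintro rfl
    exact hxj (hcast x hx).symm

theorem exists_code_of_rows {m s ℓ : ℕ} (hsm : s < m) (L : List (Finset ℕ))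
    (hlen : L.length ≤ ℓ) (hlt : ∀ R ∈ L, ∀ x ∈ R, x < m)
    (hloc : ∀ R ∈ L, ∃ i < m, ∀ x ∈ R, Knows m s i x)
    (hdec : ∀ i < m, ∃ R ∈ L, ∃ j, Exposes m s i R j ∧
      ∀ j' < m, ¬ Knows m s i j' → j' ≠ j → ∃ F, j' ∈ F ∧ IsDual m s L i F) :
    ∃ G : Fin ℓ → ZMod m → ZMod 2,
      IsDecentralizedCode m s G ∧ Correct m s G ∧ Secure m s G := by
  have : NeZero m := ⟨by omega⟩
  let G : Fin ℓ → ZMod m → ZMod 2 := fun t => indicatorRow m (L.getD t ∅)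
  have hG : ∀ v ∈ Set.range G, v = 0 ∨ ∃ R ∈ L, v = indicatorRow m R := by
    rintro _ ⟨t, rfl⟩
    rcases lt_or_ge t.val L.length with h | h
    · right
      exact ⟨L[t.val], List.getElem_mem h, by simp only [G, List.getD_eq_getElem _ _ h]⟩
    · left
      ext x
      simp only [G, List.getD_eq_default _ _ h, indicatorRow, Finset.notMem_empty, if_false, Pi.zero_apply]
  have hrange : ∀ R ∈ L, indicatorRow m R ∈ Set.range G := by
    intro R hR
    obtain ⟨t, ht, rfl⟩ := List.mem_iff_getElem.1 hR
    exact ⟨⟨t, ht.trans_le hlen⟩, by simp only [G, List.getD_eq_getElem _ _ ht]⟩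
  have key : ∀ i : ZMod m, ∃ j : ZMod m, decSet m s G i = {j} := by
    intro i
    obtain ⟨R, hR, j, hj, hsec⟩ := hdec i.val i.val_lt
    have hjm := hlt R hR j hj.1
    refine ⟨j, Set.Subset.antisymm (fun j' hj' => ?_) ?_⟩
    · by_contra hne
      have hval : j'.val ≠ j := by
        rintro rfl
        exact hne (ZMod.natCast_zmod_val j').symm
      obtain ⟨F, hjF, hF⟩ := hsec j'.val j'.val_lt
        (fun h => hj'.1 ((mem_sideInfo_iff hsm i j').2 h)) hval
      exact single_notMem_span_of_isDual hsm hF hjF hG hj'.2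
    · rintro _ rfl
      refine ⟨?_, single_mem_span_of_exposes hsm hjm hj (hrange R hR)⟩
      rw [mem_sideInfo_iff hsm, ZMod.val_cast_of_lt hjm]
      exact hj.2.1
  refine ⟨G, fun t => ?_, fun i => ?_, fun i => ?_⟩
  · rcases hG (G t) ⟨t, rfl⟩ with h | ⟨R, hR, h⟩
    · exact ⟨0, by simp [h]⟩
    · obtain ⟨i, hi, hk⟩ := hloc R hR
      refine ⟨i, fun x hx => ?_⟩
      rw [mem_sideInfo_iff hsm, ZMod.val_cast_of_lt hi]
      refine hk _ ?_
      by_contra hxR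
      exact hx (by simp [h, indicatorRow, hxR])
  · obtain ⟨j, hj⟩ := key i
    exact hj ▸ Set.singleton_nonempty j
  · obtain ⟨j, hj⟩ := key i
    exact hj ▸ Set.subsingleton_singleton

theorem isDual_singleton {m s i j : ℕ} {L : List (Finset ℕ)} (hj : j < m ∧ ¬ Knows m s i j)
    (h : ∀ R ∈ L, j ∉ R) : IsDual m s L i {j} :=
  ⟨by simpa using hj, fun R hR => by simp [h R hR]⟩

theorem isDual_pair {m s i j p : ℕ} {L : List (Finset ℕ)} (hj : j < m ∧ ¬ Knows m s i j)
    (hp : p < m ∧ ¬ Knows m s i p) (hne : j ≠ p) (h : ∀ R ∈ L, j ∈ R ↔ p ∈ R) :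
    IsDual m s L i {j, p} := by
  refine ⟨by simpa using ⟨hj, hp⟩, fun R hR => ?_⟩
  have := h R hR
  by_cases hpR : p ∈ R
  · rw [Finset.inter_eq_left.2 (by simp [Finset.insert_subset_iff, this, hpR]),
      Finset.card_pair hne]
    exact even_two
  · simp [this, hpR]

theorem isDual_triple {m s i j p r : ℕ} {L : List (Finset ℕ)} (hj : j < m ∧ ¬ Knows m s i j)
    (hp : p < m ∧ ¬ Knows m s i p) (hr : r < m ∧ ¬ Knows m s i r)
    (hjp : j ≠ p) (hjr : j ≠ r) (hpr : p ≠ r)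
    (h : ∀ R ∈ L, j ∈ R ↔ (p ∈ R ↔ r ∉ R)) :
    IsDual m s L i {j, p, r} := by
  refine ⟨by simpa using ⟨hj, hp, hr⟩, fun R hR => ?_⟩
  have := h R hR
  by_cases hpR : p ∈ R <;> by_cases hrR : r ∈ R <;>
    simp [Finset.insert_inter_of_mem, Finset.insert_inter_of_notMem, this, hpR, hrR, hjp, hjr, hpr]

theorem exists_isDual_of_disjoint {m s i j : ℕ} {L : List (Finset ℕ)} {R : Finset ℕ}
    (hlt : ∀ x ∈ R, x < m) (hdisj : ∀ R' ∈ L, ∀ x ∈ R, x ∈ R' → R' = R)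
    (hjR : j ∈ R) (hj : ¬ Knows m s i j) (hexp : ¬ Exposes m s i R j) :
    ∃ F, j ∈ F ∧ IsDual m s L i F := by
  obtain ⟨p, hp, hpj, hpk⟩ : ∃ p ∈ R, p ≠ j ∧ ¬ Knows m s i p := by
    by_contra! h
    exact hexp ⟨hjR, hj, h⟩
  refine ⟨{j, p}, by simp, isDual_pair ⟨hlt j hjR, hj⟩ ⟨hlt p hp, hpk⟩ hpj.symm
    fun R' hR' => ⟨fun h => ?_, fun h => ?_⟩⟩
  · rw [hdisj R' hR' j hjR h]; exact hp
  · rw [hdisj R' hR' p hp h]; exact hjR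

theorem exposes_pair {m s i x y : ℕ} (hx : Knows m s i x) (hy : ¬ Knows m s i y) :
    Exposes m s i {x, y} y := by
  refine ⟨by simp, hy, fun z hz hzy => ?_⟩
  rw [Finset.mem_insert, Finset.mem_singleton] at hz
  rcases hz with rfl | rfl
  · exact hx
  · exact absurd rfl hzy

theorem Exposes.of_pair {m s i x y j : ℕ} (hxy : x ≠ y) (h : Exposes m s i {x, y} j) :
    (j = y ∧ Knows m s i x ∧ ¬ Knows m s i y) ∨ (j = x ∧ Knows m s i y ∧ ¬ Knows m s i x) := by
  obtain ⟨hj, hk, h⟩ := h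
  rw [Finset.mem_insert, Finset.mem_singleton] at hj
  rcases hj with rfl | rfl
  · exact Or.inr ⟨rfl, h y (by simp) hxy.symm, hk⟩
  · exact Or.inl ⟨rfl, h x (by simp) hxy, hk⟩

/-- Consecutive blocks of `2 * s` messages, each carrying three rows with two messages. -/
def blockRows (s n : ℕ) : List (Finset ℕ) :=
  (List.range n).flatMap fun k =>
    [{2 * s * k, 2 * s * k + 1}, {2 * s * k + 3, 2 * s * k + s},
      {2 * s * k + s + 1, 2 * s * k + s + 3}]

theorem length_blockRows (s n : ℕ) : (blockRows s n).length = 3 * n := by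
  simp [blockRows, mul_comm]

theorem mem_blockRows {s n : ℕ} (hs : 0 < s) {R : Finset ℕ} :
    R ∈ blockRows s n ↔ ∃ P, 2 * s ∣ P ∧ P + 2 * s ≤ 2 * s * n ∧
      (R = {P, P + 1} ∨ R = {P + 3, P + s} ∨ R = {P + s + 1, P + s + 3}) := by
  simp only [blockRows, List.mem_flatMap, List.mem_range, List.mem_cons, List.not_mem_nil,
    or_false]
  constructor
  · rintro ⟨k, hk, h⟩
    refine ⟨2 * s * k, dvd_mul_right _ _, ?_, h⟩
    rw [← mul_add_one]
    exact Nat.mul_le_mul_left _ hk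
  · rintro ⟨_, ⟨k, rfl⟩, hk, h⟩
    refine ⟨k, ?_, h⟩
    rw [← mul_add_one] at hk
    exact Nat.le_of_mul_le_mul_left hk (by omega)

theorem multiples_cases {s P P' : ℕ} (h : 2 * s ∣ P) (h' : 2 * s ∣ P') :
    P = P' ∨ P + 2 * s = P' ∨ P' + 2 * s = P ∨ P + 4 * s ≤ P' ∨ P' + 4 * s ≤ P := by
  obtain ⟨k, rfl⟩ := h
  obtain ⟨k', rfl⟩ := h'
  rcases lt_trichotomy k k' with hk | rfl | hk
  · obtain ⟨d, rfl⟩ := Nat.exists_eq_add_of_lt hk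
    rcases Nat.eq_zero_or_pos d with rfl | hd
    · right; left; ring
    · right; right; right; left
      nlinarith
  · exact Or.inl rfl
  · obtain ⟨d, rfl⟩ := Nat.exists_eq_add_of_lt hk
    rcases Nat.eq_zero_or_pos d with rfl | hd
    · right; right; left; ring
    · right; right; right; right
      nlinarith

/-- The row completing the blocks when `6 ≤ s`, where `M` is the end of the last block. -/
def closingRow (s M : ℕ) : Finset ℕ :=
  {M, M + 1, M + 4 - s, M + 6 - s}

section
variable {s q : ℕ} {R R' : Finset ℕ}

theorem mem_rows_of_six_le (hs : 6 ≤ s) :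
    R ∈ blockRows s q ++ [closingRow s (2 * s * q)] ↔
      (∃ P, 2 * s ∣ P ∧ P + 2 * s ≤ 2 * s * q ∧
        (R = {P, P + 1} ∨ R = {P + 3, P + s} ∨ R = {P + s + 1, P + s + 3})) ∨
      R = closingRow s (2 * s * q) := by
  rw [List.mem_append, mem_blockRows (by omega), List.mem_singleton]

theorem disjoint_rows_of_six_le (hs : 6 ≤ s) (hq : 1 ≤ q)
    (hR : R ∈ blockRows s q ++ [closingRow s (2 * s * q)])
    (hR' : R' ∈ blockRows s q ++ [closingRow s (2 * s * q)]) :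
    ∀ x ∈ R, x ∈ R' → R' = R := by
  have hM : 2 * s ≤ 2 * s * q := Nat.le_mul_of_pos_right _ hq
  rw [mem_rows_of_six_le hs] at hR hR'
  intro x hx hx'
  rcases hR with ⟨P, hP, hPM, rfl | rfl | rfl⟩ | rfl <;>
  rcases hR' with ⟨P', hP', hPM', rfl | rfl | rfl⟩ | rfl <;>
  simp only [closingRow, Finset.mem_insert, Finset.mem_singleton] at hx hx' <;>
  first
  | rfl
  | (exfalso; omega)
  | (have := multiples_cases hP hP'
     first
     | (exfalso; omega)
     | (obtain rfl : P = P' := by omega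
        rfl))

theorem exposes_cases_of_six_le (hs : 6 ≤ s) (hq : 1 ≤ q) {i j P : ℕ}
    (hP : 2 * s ∣ P) (hPi : P ≤ i) (hiP : i < P + 2 * s) (hi : i < 2 * s * q + 3)
    (hR : R ∈ blockRows s q ++ [closingRow s (2 * s * q)])
    (hj : Exposes (2 * s * q + 3) s i R j) :
    (i = P → j = P + 1) ∧ (P = 0 → 1 ≤ i → i < 3 → j = 2 * s * q + 4 - s) ∧
    (2 * s ≤ P → P + 1 ≤ i → i < P + 3 → j = P + 1 - s) ∧
    (P + 3 ≤ i → i < P + s → j = P + s) ∧ (i = P + s → j = P) ∧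
    (P + s + 1 ≤ i → i < P + s + 3 → j = P + s + 3) ∧ (P + s + 3 ≤ i → j = P + 3) := by
  have hM : 2 * s ≤ 2 * s * q := Nat.le_mul_of_pos_right _ hq
  have hMP : P = 2 * s * q ∨ P + 2 * s ≤ 2 * s * q := by
    have := multiples_cases hP (dvd_mul_right (2 * s) q)
    omega
  have hP0 : P = 0 ∨ 2 * s ≤ P := by
    have := multiples_cases hP (dvd_zero (2 * s))
    omega
  rw [mem_rows_of_six_le hs] at hR
  generalize 2 * s * q = M at *
  rcases hR with ⟨P', hP', hPM', hR⟩ | rfl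
  · have hPP : P = P' ∨ P' + 2 * s = P ∨ P' + 4 * s ≤ P ∨ P + 2 * s ≤ P' := by
      have := multiples_cases hP hP'
      omega
    rcases hR with rfl | rfl | rfl <;>
    rcases hj.of_pair (by omega) with ⟨rfl, h1, h2⟩ | ⟨rfl, h1, h2⟩ <;>
    simp only [Knows] at h1 h2 <;>
    rcases hPP with rfl | rfl | hPP | hPP <;>
    rcases h1 with ⟨h1, h3⟩ | h1 <;>
    first
    | (exfalso; omega)
    | (refine ⟨fun _ => ?_, fun _ _ _ => ?_, fun _ _ _ => ?_, fun _ _ => ?_, fun _ => ?_,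
        fun _ _ => ?_, fun _ => ?_⟩ <;> omega)
  · obtain ⟨h1, h2, h3⟩ := hj
    simp only [closingRow, Finset.mem_insert, Finset.mem_singleton, forall_eq_or_imp, forall_eq,
      Knows] at h1 h2 h3
    obtain ⟨h3, h4, h5, h6⟩ := h3
    rcases h1 with rfl | rfl | rfl | rfl <;> rcases hMP with rfl | hMP <;>
    first
    | (exfalso; omega)
    | (refine ⟨fun _ => ?_, fun _ _ _ => ?_, fun _ _ _ => ?_, fun _ _ => ?_, fun _ => ?_,
        fun _ _ => ?_, fun _ => ?_⟩ <;> omega)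

theorem exists_exposes_of_six_le (hs : 6 ≤ s) (hq : 1 ≤ q) {i P : ℕ}
    (hP : 2 * s ∣ P) (hPi : P ≤ i) (hiP : i < P + 2 * s) (hi : i < 2 * s * q + 3) :
    ∃ R ∈ blockRows s q ++ [closingRow s (2 * s * q)], ∃ j,
      Exposes (2 * s * q + 3) s i R j := by
  have hM : 2 * s ≤ 2 * s * q := Nat.le_mul_of_pos_right _ hq
  have hMP := multiples_cases hP (dvd_mul_right (2 * s) q)
  have hP0 := multiples_cases hP (dvd_zero (2 * s))
  simp only [mem_rows_of_six_le hs]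
  generalize 2 * s * q = M at *
  rcases Nat.lt_or_ge i (M) with hiM | hiM
  · have hPM : P + 2 * s ≤ M := by omega
    rcases Nat.lt_or_ge i (P + 1) with h | h
    · exact ⟨_, Or.inl ⟨P, hP, hPM, Or.inl rfl⟩, _,
        exposes_pair (by simp only [Knows]; omega) (by simp only [Knows]; omega)⟩
    rcases Nat.lt_or_ge i (P + 3) with h | h
    · rcases Nat.lt_or_ge P (2 * s) with h0 | h0
      · refine ⟨_, Or.inr rfl, M + 4 - s, ?_⟩
        refine ⟨by simp [closingRow], by simp only [Knows]; omega, fun x hx hne => ?_⟩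
        simp only [closingRow, Finset.mem_insert, Finset.mem_singleton] at hx
        simp only [Knows]
        omega
      · refine ⟨_, Or.inl ⟨P - 2 * s, Nat.dvd_sub hP dvd_rfl, by omega,
          Or.inr (Or.inr (Finset.pair_comm _ _))⟩, _,
          exposes_pair (by simp only [Knows]; omega) (by simp only [Knows]; omega)⟩
    rcases Nat.lt_or_ge i (P + s) with h | h
    · exact ⟨_, Or.inl ⟨P, hP, hPM, Or.inr (Or.inl rfl)⟩, _,
        exposes_pair (by simp only [Knows]; omega) (by simp only [Knows]; omega)⟩
    rcases Nat.lt_or_ge i (P + s + 1) with h | h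
    · exact ⟨_, Or.inl ⟨P, hP, hPM, Or.inl (Finset.pair_comm _ _)⟩, _,
        exposes_pair (by simp only [Knows]; omega) (by simp only [Knows]; omega)⟩
    rcases Nat.lt_or_ge i (P + s + 3) with h | h
    · exact ⟨_, Or.inl ⟨P, hP, hPM, Or.inr (Or.inr rfl)⟩, _,
        exposes_pair (by simp only [Knows]; omega) (by simp only [Knows]; omega)⟩
    · exact ⟨_, Or.inl ⟨P, hP, hPM, Or.inr (Or.inl (Finset.pair_comm _ _))⟩, _,
        exposes_pair (by simp only [Knows]; omega) (by simp only [Knows]; omega)⟩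
  · rcases Nat.lt_or_ge i (M + 1) with h | h
    · refine ⟨_, Or.inr rfl, M + 1, ?_⟩
      refine ⟨by simp [closingRow], by simp only [Knows]; omega, fun x hx hne => ?_⟩
      simp only [closingRow, Finset.mem_insert, Finset.mem_singleton] at hx
      simp only [Knows]
      omega
    · refine ⟨_, Or.inl ⟨P - 2 * s, Nat.dvd_sub hP dvd_rfl, by omega,
        Or.inr (Or.inr (Finset.pair_comm _ _))⟩, _,
        exposes_pair (by simp only [Knows]; omega) (by simp only [Knows]; omega)⟩

theorem exists_code_of_six_le (hs : 6 ≤ s) (hq : 1 ≤ q) {ℓ : ℕ} (hℓ : 3 * q + 1 ≤ ℓ) :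
    ∃ G : Fin ℓ → ZMod (2 * s * q + 3) → ZMod 2,
      IsDecentralizedCode (2 * s * q + 3) s G ∧ Correct (2 * s * q + 3) s G ∧
        Secure (2 * s * q + 3) s G := by
  have hM : 2 * s ≤ 2 * s * q := Nat.le_mul_of_pos_right _ hq
  have hlt : ∀ R ∈ blockRows s q ++ [closingRow s (2 * s * q)], ∀ x ∈ R,
      x < 2 * s * q + 3 := by
    intro R hR
    rw [mem_rows_of_six_le hs] at hR
    rcases hR with ⟨P', hP', hPM', rfl | rfl | rfl⟩ | rfl <;>
      simp only [closingRow, Finset.mem_insert, Finset.mem_singleton, forall_eq_or_imp,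
        forall_eq] <;> omega
  refine exists_code_of_rows (by omega) (blockRows s q ++ [closingRow s (2 * s * q)])
    (by simpa [length_blockRows] using hℓ) hlt (fun R hR => ?_) (fun i hi => ?_)
  · rw [mem_rows_of_six_le hs] at hR
    rcases hR with ⟨P, hP, hPM, rfl | rfl | rfl⟩ | rfl <;>
      simp only [closingRow, Finset.mem_insert, Finset.mem_singleton, forall_eq_or_imp,
        forall_eq, Knows]
    · exact ⟨P + 1, by omega⟩
    · exact ⟨P + s, by omega⟩
    · exact ⟨P + s + 3, by omega⟩
    · exact ⟨2 * s * q + 1, by omega⟩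
  · have hP := dvd_mul_right (2 * s) (i / (2 * s))
    set P := 2 * s * (i / (2 * s))
    have hPi := Nat.mul_div_le i (2 * s)
    have hiP := Nat.lt_mul_div_succ i (show 0 < 2 * s by omega)
    rw [mul_add_one] at hiP
    obtain ⟨R, hR, j, hj⟩ := exists_exposes_of_six_le hs hq hP hPi hiP hi
    refine ⟨R, hR, j, hj, fun j' hj'm hj' hne => ?_⟩
    by_cases hex : ∃ R' ∈ blockRows s q ++ [closingRow s (2 * s * q)], j' ∈ R'
    · obtain ⟨R', hR', hjR'⟩ := hex
      refine exists_isDual_of_disjoint (hlt R' hR')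
        (fun R'' hR'' => disjoint_rows_of_six_le hs hq hR' hR'') hjR' hj' fun hexp => hne ?_
      have h1 := exposes_cases_of_six_le hs hq hP hPi hiP hi hR hj
      have h2 := exposes_cases_of_six_le hs hq hP hPi hiP hi hR' hexp
      have hP0 : P = 0 ∨ 2 * s ≤ P := by
        have := multiples_cases hP (dvd_zero (2 * s))
        omega
      omega
    · push Not at hex
      exact ⟨{j'}, by simp, isDual_singleton ⟨hj'm, hj'⟩ hex⟩

end

/-- The rows completing the blocks when `s = 5`, where `b` is the end of the last block. -/
def closingRowsFive (b : ℕ) : List (Finset ℕ) :=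
  [{b, b + 1}, {b + 2, b + 3, b + 5}, {b + 5, b + 6, b + 7}, {b + 7, b + 8, b + 10},
    {b + 9, b + 11, b + 12}]

section
variable {n : ℕ} {R R' : Finset ℕ}

theorem mem_rows_five :
    R ∈ blockRows 5 n ++ closingRowsFive (10 * n) ↔
      (∃ k < n, R = {10 * k, 10 * k + 1} ∨ R = {10 * k + 3, 10 * k + 5} ∨
        R = {10 * k + 6, 10 * k + 8}) ∨
      R = {10 * n, 10 * n + 1} ∨ R = {10 * n + 2, 10 * n + 3, 10 * n + 5} ∨
      R = {10 * n + 5, 10 * n + 6, 10 * n + 7} ∨ R = {10 * n + 7, 10 * n + 8, 10 * n + 10} ∨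
      R = {10 * n + 9, 10 * n + 11, 10 * n + 12} := by
  simp [blockRows, closingRowsFive]

theorem disjoint_rows_five
    (hR : (∃ k < n, R = {10 * k, 10 * k + 1} ∨ R = {10 * k + 3, 10 * k + 5} ∨
      R = {10 * k + 6, 10 * k + 8}) ∨ R = {10 * n, 10 * n + 1} ∨
      R = {10 * n + 9, 10 * n + 11, 10 * n + 12})
    (hR' : R' ∈ blockRows 5 n ++ closingRowsFive (10 * n)) :
    ∀ x ∈ R, x ∈ R' → R' = R := by
  rw [mem_rows_five] at hR'
  intro x hx hx'
  rcases hR with ⟨k, hk, rfl | rfl | rfl⟩ | rfl | rfl <;>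
  rcases hR' with ⟨k', hk', rfl | rfl | rfl⟩ | rfl | rfl | rfl | rfl | rfl <;>
  simp only [Finset.mem_insert, Finset.mem_singleton] at hx hx' <;>
  first
  | rfl
  | (exfalso; omega)
  | (obtain rfl : k = k' := by omega
     rfl)

/-- The message decoded by user `i` when `s = 5`. -/
def targetFive (n i : ℕ) : ℕ :=
  if i < 10 * n + 3 then
    if i % 10 = 0 then i + 1
    else if i % 10 < 3 then if i < 3 then 10 * n + 9 else i - i % 10 - 4
    else if i % 10 < 5 then i - i % 10 + 5
    else if i % 10 = 5 then i - 5
    else if i % 10 < 8 then i - i % 10 + 8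
    else i - i % 10 + 3
  else if i < 10 * n + 5 then 10 * n + 5
  else if i = 10 * n + 5 then 10 * n
  else if i = 10 * n + 6 then 10 * n + 7
  else if i = 10 * n + 7 then 10 * n + 2
  else if i < 10 * n + 10 then 10 * n + 10
  else if i = 10 * n + 10 then 10 * n + 5
  else if i = 10 * n + 11 then 10 * n + 12
  else 10 * n + 7

theorem Exposes.of_pair_of_lt {m s i x y j : ℕ} (hxy : x < y) (hyx : y < x + s)
    (hym : y + s ≤ m) (h : Exposes m s i {x, y} j) :
    j = y ∧ x ≤ i ∧ i < y ∨ j = x ∧ x + s ≤ i ∧ i < y + s := by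
  rcases h.of_pair hxy.ne with ⟨rfl, h1, h2⟩ | ⟨rfl, h1, h2⟩ <;>
  simp only [Knows] at h1 h2 <;>
  omega

theorem eq_targetFive_of_exposes_block {k i j : ℕ} (hk : k < n)
    (hR : R = {10 * k, 10 * k + 1} ∨ R = {10 * k + 3, 10 * k + 5} ∨ R = {10 * k + 6, 10 * k + 8})
    (hj : Exposes (10 * n + 13) 5 i R j) : j = targetFive n i := by
  rcases hR with rfl | rfl | rfl <;>
  rcases hj.of_pair_of_lt (by omega) (by omega) (by omega) with ⟨rfl, h1, h2⟩ | ⟨rfl, h1, h2⟩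
  · obtain rfl : i = 10 * k := by omega
    simp [targetFive, show 10 * k < 10 * n + 3 by omega]
  · obtain rfl : i = 10 * k + 5 := by omega
    simp [targetFive, show 10 * k + 5 < 10 * n + 3 by omega]
  · obtain rfl | rfl : i = 10 * k + 3 ∨ i = 10 * k + 4 := by omega
    · simp [targetFive, show 10 * k + 3 < 10 * n + 3 by omega]
    · simp [targetFive, show 10 * k + 4 < 10 * n + 3 by omega]
  · obtain rfl | rfl : i = 10 * k + 8 ∨ i = 10 * k + 9 := by omega
    · simp [targetFive, show 10 * k + 8 < 10 * n + 3 by omega]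
    · simp [targetFive, show 10 * k + 9 < 10 * n + 3 by omega]
  · obtain rfl | rfl : i = 10 * k + 6 ∨ i = 10 * k + 7 := by omega
    · simp [targetFive, show 10 * k + 6 < 10 * n + 3 by omega]
    · simp [targetFive, show 10 * k + 7 < 10 * n + 3 by omega]
  · obtain rfl | rfl : i = 10 * k + 11 ∨ i = 10 * k + 12 := by omega
    · simp [targetFive, show 10 * k + 11 < 10 * n + 3 by omega]
    · simp [targetFive, show 10 * k + 12 < 10 * n + 3 by omega]

theorem exposes_triple_iff {m s i x y z j : ℕ} (hxy : x ≠ y) (hxz : x ≠ z) (hyz : y ≠ z) :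
    Exposes m s i {x, y, z} j ↔ (j = x ∧ ¬ Knows m s i x ∧ Knows m s i y ∧ Knows m s i z) ∨
      (j = y ∧ ¬ Knows m s i y ∧ Knows m s i x ∧ Knows m s i z) ∨
      (j = z ∧ ¬ Knows m s i z ∧ Knows m s i x ∧ Knows m s i y) := by
  constructor
  · rintro ⟨h1, h2, h3⟩
    simp only [Finset.mem_insert, Finset.mem_singleton, forall_eq_or_imp, forall_eq] at h1 h3
    grind
  · rintro (⟨rfl, h⟩ | ⟨rfl, h⟩ | ⟨rfl, h⟩) <;> refine ⟨by simp, h.1, ?_⟩ <;> simp <;> grind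

theorem eq_targetFive_of_exposes_closing {i j : ℕ} (hi : i < 10 * n + 13)
    (hR : R = {10 * n, 10 * n + 1} ∨ R = {10 * n + 2, 10 * n + 3, 10 * n + 5} ∨
      R = {10 * n + 5, 10 * n + 6, 10 * n + 7} ∨ R = {10 * n + 7, 10 * n + 8, 10 * n + 10} ∨
      R = {10 * n + 9, 10 * n + 11, 10 * n + 12})
    (hj : Exposes (10 * n + 13) 5 i R j) : j = targetFive n i := by
  rcases hR with rfl | hR
  · rcases hj.of_pair_of_lt (by omega) (by omega) (by omega) with ⟨rfl, h1, h2⟩ | ⟨rfl, h1, h2⟩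
    · obtain rfl : i = 10 * n := by omega
      simp [targetFive]
    · obtain rfl : i = 10 * n + 5 := by omega
      simp [targetFive]
  rcases hR with rfl | rfl | rfl | rfl <;>
  rw [exposes_triple_iff (by omega) (by omega) (by omega)] at hj <;>
  simp only [Knows] at hj <;>
  rcases hj with ⟨rfl, h1, h2, h3⟩ | ⟨rfl, h1, h2, h3⟩ | ⟨rfl, h1, h2, h3⟩
  · obtain rfl : i = 10 * n + 7 := by omega
    simp [targetFive]
  · omega
  · obtain rfl | rfl : i = 10 * n + 3 ∨ i = 10 * n + 4 := by omega
    all_goals simp [targetFive]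
  · obtain rfl : i = 10 * n + 10 := by omega
    simp [targetFive]
  · omega
  · obtain rfl : i = 10 * n + 6 := by omega
    simp [targetFive]
  · obtain rfl : i = 10 * n + 12 := by omega
    simp [targetFive]
  · omega
  · obtain rfl | rfl : i = 10 * n + 8 ∨ i = 10 * n + 9 := by omega
    all_goals simp [targetFive]
  · obtain rfl | rfl : i = 1 ∨ i = 2 := by omega
    all_goals simp [targetFive]
  · omega
  · obtain rfl : i = 10 * n + 11 := by omega
    simp [targetFive]

theorem eq_targetFive_of_exposes {i j : ℕ} (hi : i < 10 * n + 13)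
    (hR : R ∈ blockRows 5 n ++ closingRowsFive (10 * n))
    (hj : Exposes (10 * n + 13) 5 i R j) : j = targetFive n i := by
  rcases mem_rows_five.1 hR with ⟨k, hk, hR⟩ | hR
  · exact eq_targetFive_of_exposes_block hk hR hj
  · exact eq_targetFive_of_exposes_closing hi hR hj

theorem exists_exposes_five {i : ℕ} (hi : i < 10 * n + 13) :
    ∃ R ∈ blockRows 5 n ++ closingRowsFive (10 * n), ∃ j, Exposes (10 * n + 13) 5 i R j := by
  simp only [mem_rows_five]
  rcases Nat.lt_or_ge i 3 with h3 | h3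
  · rcases Nat.eq_zero_or_pos i with rfl | h0
    · rcases Nat.eq_zero_or_pos n with rfl | hn
      · exact ⟨_, Or.inr (Or.inl rfl), _,
          exposes_pair (by simp only [Knows]; omega) (by simp only [Knows]; omega)⟩
      · exact ⟨_, Or.inl ⟨0, hn, Or.inl rfl⟩, _,
          exposes_pair (by simp only [Knows]; omega) (by simp only [Knows]; omega)⟩
    · exact ⟨_, Or.inr (Or.inr (Or.inr (Or.inr (Or.inr rfl)))), _,
        (exposes_triple_iff (by omega) (by omega) (by omega)).2 <| Or.inl
          ⟨rfl, by simp only [Knows]; omega, by simp only [Knows]; omega,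
            by simp only [Knows]; omega⟩⟩
  rcases Nat.lt_or_ge i (10 * n + 3) with hin | hin
  · obtain ⟨k, r, hr, hk, rfl⟩ : ∃ k r, r < 10 ∧ k < n ∧ i = 10 * k + r + 3 :=
      ⟨(i - 3) / 10, (i - 3) % 10, by omega, by omega, by omega⟩
    rcases Nat.lt_or_ge r 2 with h | h
    · exact ⟨_, Or.inl ⟨k, hk, Or.inr (Or.inl rfl)⟩, _,
          exposes_pair (by simp only [Knows]; omega) (by simp only [Knows]; omega)⟩
    rcases Nat.lt_or_ge r 3 with h | h
    · exact ⟨_, Or.inl ⟨k, hk, Or.inl (Finset.pair_comm _ _)⟩, _,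
          exposes_pair (by simp only [Knows]; omega) (by simp only [Knows]; omega)⟩
    rcases Nat.lt_or_ge r 5 with h | h
    · exact ⟨_, Or.inl ⟨k, hk, Or.inr (Or.inr rfl)⟩, _,
          exposes_pair (by simp only [Knows]; omega) (by simp only [Knows]; omega)⟩
    rcases Nat.lt_or_ge r 7 with h | h
    · exact ⟨_, Or.inl ⟨k, hk, Or.inr (Or.inl (Finset.pair_comm _ _))⟩, _,
          exposes_pair (by simp only [Knows]; omega) (by simp only [Knows]; omega)⟩
    rcases Nat.lt_or_ge r 8 with h | h
    · rcases (Nat.succ_le_of_lt hk).eq_or_lt with rfl | hk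
      · exact ⟨_, Or.inr (Or.inl rfl), _,
            exposes_pair (by simp only [Knows]; omega) (by simp only [Knows]; omega)⟩
      · exact ⟨_, Or.inl ⟨k + 1, hk, Or.inl rfl⟩, _,
            exposes_pair (by simp only [Knows]; omega) (by simp only [Knows]; omega)⟩
    · exact ⟨_, Or.inl ⟨k, hk, Or.inr (Or.inr (Finset.pair_comm _ _))⟩, _,
          exposes_pair (by simp only [Knows]; omega) (by simp only [Knows]; omega)⟩
  · obtain ⟨u, rfl⟩ := Nat.exists_eq_add_of_le hin
    replace hi : u < 10 := by omega
    interval_cases u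
    · exact ⟨_, Or.inr (Or.inr (Or.inl rfl)), _,
          (exposes_triple_iff (by omega) (by omega) (by omega)).2 <| Or.inr <| Or.inr
            ⟨rfl, by simp only [Knows]; omega, by simp only [Knows]; omega,
            by simp only [Knows]; omega⟩⟩
    · exact ⟨_, Or.inr (Or.inr (Or.inl rfl)), _,
          (exposes_triple_iff (by omega) (by omega) (by omega)).2 <| Or.inr <| Or.inr
            ⟨rfl, by simp only [Knows]; omega, by simp only [Knows]; omega,
            by simp only [Knows]; omega⟩⟩
    · exact ⟨_, Or.inr (Or.inl (Finset.pair_comm _ _)), _,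
          exposes_pair (by simp only [Knows]; omega) (by simp only [Knows]; omega)⟩
    · exact ⟨_, Or.inr (Or.inr (Or.inr (Or.inl rfl))), _,
          (exposes_triple_iff (by omega) (by omega) (by omega)).2 <| Or.inr <| Or.inr
            ⟨rfl, by simp only [Knows]; omega, by simp only [Knows]; omega,
            by simp only [Knows]; omega⟩⟩
    · exact ⟨_, Or.inr (Or.inr (Or.inl rfl)), _,
          (exposes_triple_iff (by omega) (by omega) (by omega)).2 <| Or.inl
            ⟨rfl, by simp only [Knows]; omega, by simp only [Knows]; omega,
            by simp only [Knows]; omega⟩⟩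
    · exact ⟨_, Or.inr (Or.inr (Or.inr (Or.inr (Or.inl rfl)))), _,
          (exposes_triple_iff (by omega) (by omega) (by omega)).2 <| Or.inr <| Or.inr
            ⟨rfl, by simp only [Knows]; omega, by simp only [Knows]; omega,
            by simp only [Knows]; omega⟩⟩
    · exact ⟨_, Or.inr (Or.inr (Or.inr (Or.inr (Or.inl rfl)))), _,
          (exposes_triple_iff (by omega) (by omega) (by omega)).2 <| Or.inr <| Or.inr
            ⟨rfl, by simp only [Knows]; omega, by simp only [Knows]; omega,
            by simp only [Knows]; omega⟩⟩
    · exact ⟨_, Or.inr (Or.inr (Or.inr (Or.inl rfl))), _,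
          (exposes_triple_iff (by omega) (by omega) (by omega)).2 <| Or.inl
            ⟨rfl, by simp only [Knows]; omega, by simp only [Knows]; omega,
            by simp only [Knows]; omega⟩⟩
    · exact ⟨_, Or.inr (Or.inr (Or.inr (Or.inr (Or.inr rfl)))), _,
          (exposes_triple_iff (by omega) (by omega) (by omega)).2 <| Or.inr <| Or.inr
            ⟨rfl, by simp only [Knows]; omega, by simp only [Knows]; omega,
            by simp only [Knows]; omega⟩⟩
    · exact ⟨_, Or.inr (Or.inr (Or.inr (Or.inr (Or.inl rfl)))), _,
          (exposes_triple_iff (by omega) (by omega) (by omega)).2 <| Or.inl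
            ⟨rfl, by simp only [Knows]; omega, by simp only [Knows]; omega,
            by simp only [Knows]; omega⟩⟩

/-- Pairs and triples of messages meeting every row in an even number of messages. -/
theorem parity_rows_five (hR : R ∈ blockRows 5 n ++ closingRowsFive (10 * n)) :
    (10 * n + 2 ∈ R ↔ 10 * n + 3 ∈ R) ∧ (10 * n + 8 ∈ R ↔ 10 * n + 10 ∈ R) ∧
    (10 * n + 5 ∈ R ↔ (10 * n + 2 ∈ R ↔ 10 * n + 6 ∉ R)) ∧
    (10 * n + 7 ∈ R ↔ (10 * n + 6 ∈ R ↔ 10 * n + 8 ∉ R)) := by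
  rw [mem_rows_five] at hR
  rcases hR with ⟨k, hk, rfl | rfl | rfl⟩ | rfl | rfl | rfl | rfl | rfl <;>
  simp <;>
  omega

theorem exists_isDual_five {i j : ℕ}
    (hj : j = 10 * n + 2 ∨ j = 10 * n + 3 ∨ j = 10 * n + 5 ∨ j = 10 * n + 6 ∨
      j = 10 * n + 7 ∨ j = 10 * n + 8 ∨ j = 10 * n + 10)
    (hk : ¬ Knows (10 * n + 13) 5 i j)
    (hexp : ∀ R ∈ blockRows 5 n ++ closingRowsFive (10 * n), ¬ Exposes (10 * n + 13) 5 i R j) :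
    ∃ F, j ∈ F ∧ IsDual (10 * n + 13) 5 (blockRows 5 n ++ closingRowsFive (10 * n)) i F := by
  have dual (F : Finset ℕ) (hF : F = {10 * n + 2, 10 * n + 3} ∨ F = {10 * n + 8, 10 * n + 10} ∨
      F = {10 * n + 5, 10 * n + 2, 10 * n + 6} ∨ F = {10 * n + 5, 10 * n + 3, 10 * n + 6} ∨
      F = {10 * n + 7, 10 * n + 6, 10 * n + 8} ∨ F = {10 * n + 7, 10 * n + 6, 10 * n + 10})
      (hu : ∀ x ∈ F, ¬ Knows (10 * n + 13) 5 i x) :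
      IsDual (10 * n + 13) 5 (blockRows 5 n ++ closingRowsFive (10 * n)) i F := by
    have hlt : ∀ x ∈ F, x < 10 * n + 13 ∧ ¬ Knows (10 * n + 13) 5 i x := by
      refine fun x hx => ⟨?_, hu x hx⟩
      rcases hF with rfl | rfl | rfl | rfl | rfl | rfl <;> simp at hx <;> omega
    rcases hF with rfl | rfl | rfl | rfl | rfl | rfl
    · exact isDual_pair (hlt _ (by simp)) (hlt _ (by simp)) (by simp)
        fun R hR => (parity_rows_five hR).1
    · exact isDual_pair (hlt _ (by simp)) (hlt _ (by simp)) (by simp)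
        fun R hR => (parity_rows_five hR).2.1
    · exact isDual_triple (hlt _ (by simp)) (hlt _ (by simp)) (hlt _ (by simp)) (by simp)
        (by simp) (by simp) fun R hR => (parity_rows_five hR).2.2.1
    · exact isDual_triple (hlt _ (by simp)) (hlt _ (by simp)) (hlt _ (by simp)) (by simp)
        (by simp) (by simp) fun R hR => by
          rw [← (parity_rows_five hR).1]; exact (parity_rows_five hR).2.2.1
    · exact isDual_triple (hlt _ (by simp)) (hlt _ (by simp)) (hlt _ (by simp)) (by simp)
        (by simp) (by simp) fun R hR => (parity_rows_five hR).2.2.2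
    · exact isDual_triple (hlt _ (by simp)) (hlt _ (by simp)) (hlt _ (by simp)) (by simp)
        (by simp) (by simp) fun R hR => by
          rw [← (parity_rows_five hR).2.1]; exact (parity_rows_five hR).2.2.2
  by_contra! hno
  have h2 := hexp {10 * n + 2, 10 * n + 3, 10 * n + 5} (by simp [closingRowsFive])
  have h3 := hexp {10 * n + 5, 10 * n + 6, 10 * n + 7} (by simp [closingRowsFive])
  have h4 := hexp {10 * n + 7, 10 * n + 8, 10 * n + 10} (by simp [closingRowsFive])
  rw [exposes_triple_iff (by omega) (by omega) (by omega)] at h2 h3 h4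
  have known (F : Finset ℕ) (hF : (∀ x ∈ F, ¬ Knows (10 * n + 13) 5 i x) →
      IsDual (10 * n + 13) 5 (blockRows 5 n ++ closingRowsFive (10 * n)) i F) (hjF : j ∈ F) :
      ∃ x ∈ F, Knows (10 * n + 13) 5 i x := by
    by_contra! hu
    exact hno F hjF (hF hu)
  have k1 := known _ (dual {10 * n + 2, 10 * n + 3} (by simp))
  have k2 := known _ (dual {10 * n + 8, 10 * n + 10} (by simp))
  have k3 := known _ (dual {10 * n + 5, 10 * n + 2, 10 * n + 6} (by simp))
  have k4 := known _ (dual {10 * n + 5, 10 * n + 3, 10 * n + 6} (by simp))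
  have k5 := known _ (dual {10 * n + 7, 10 * n + 6, 10 * n + 8} (by simp))
  have k6 := known _ (dual {10 * n + 7, 10 * n + 6, 10 * n + 10} (by simp))
  simp only [Finset.mem_insert, Finset.mem_singleton, exists_eq_or_imp, exists_eq_left]
    at k1 k2 k3 k4 k5 k6
  clear hexp dual known hno
  rcases hj with rfl | rfl | rfl | rfl | rfl | rfl | rfl <;>
  simp [hk] at h2 h3 h4 k1 k2 k3 k4 k5 k6 <;>
  simp only [Knows] at * <;>
  omega

/-- The construction for `s = 5`. -/
theorem exists_code_five {ℓ : ℕ} (hℓ : 3 * n + 5 ≤ ℓ) :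
    ∃ G : Fin ℓ → ZMod (10 * n + 13) → ZMod 2,
      IsDecentralizedCode (10 * n + 13) 5 G ∧ Correct (10 * n + 13) 5 G ∧
        Secure (10 * n + 13) 5 G := by
  have hlt : ∀ R ∈ blockRows 5 n ++ closingRowsFive (10 * n), ∀ x ∈ R, x < 10 * n + 13 := by
    intro R hR
    rw [mem_rows_five] at hR
    rcases hR with ⟨k, hk, rfl | rfl | rfl⟩ | rfl | rfl | rfl | rfl | rfl <;>
      simp only [Finset.mem_insert, Finset.mem_singleton, forall_eq_or_imp, forall_eq] <;> omega
  refine exists_code_of_rows (by omega) (blockRows 5 n ++ closingRowsFive (10 * n))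
    (by simpa [length_blockRows, closingRowsFive] using hℓ) hlt (fun R hR => ?_) (fun i hi => ?_)
  · rw [mem_rows_five] at hR
    rcases hR with ⟨k, hk, rfl | rfl | rfl⟩ | rfl | rfl | rfl | rfl | rfl <;>
      simp only [Finset.mem_insert, Finset.mem_singleton, forall_eq_or_imp, forall_eq, Knows]
    · exact ⟨10 * k + 1, by omega⟩
    · exact ⟨10 * k + 5, by omega⟩
    · exact ⟨10 * k + 8, by omega⟩
    · exact ⟨10 * n + 1, by omega⟩
    · exact ⟨10 * n + 5, by omega⟩
    · exact ⟨10 * n + 7, by omega⟩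
    · exact ⟨10 * n + 10, by omega⟩
    · exact ⟨10 * n + 12, by omega⟩
  · obtain ⟨R, hR, j, hj⟩ := exists_exposes_five hi
    refine ⟨R, hR, j, hj, fun j' hj'm hj' hne => ?_⟩
    have hexp : ∀ R ∈ blockRows 5 n ++ closingRowsFive (10 * n),
        ¬ Exposes (10 * n + 13) 5 i R j' := fun R' hR' h =>
      hne ((eq_targetFive_of_exposes hi hR' h).trans (eq_targetFive_of_exposes hi hR hj).symm)
    by_cases hex : ∃ R' ∈ blockRows 5 n ++ closingRowsFive (10 * n), j' ∈ R'
    · obtain ⟨R', hR', hjR'⟩ := hex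
      have disjoint (h) := exists_isDual_of_disjoint (hlt R' hR')
        (fun R'' hR'' => disjoint_rows_five (n := n) h hR'') hjR' hj' (hexp R' hR')
      have overlap (h) := exists_isDual_five (i := i) (j := j') (n := n) h hj' hexp
      rcases mem_rows_five.1 hR' with h | h | h | h | h | h
      · exact disjoint (Or.inl h)
      · exact disjoint (Or.inr (Or.inl h))
      · subst h; simp at hjR'; exact overlap (by omega)
      · subst h; simp at hjR'; exact overlap (by omega)
      · subst h; simp at hjR'; exact overlap (by omega)
      · exact disjoint (Or.inr (Or.inr h))
    · push Not at hex
      exact ⟨{j'}, by simp, isDual_singleton ⟨hj'm, hj'⟩ hex⟩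

end

end SDPicod

open SDPicod

theorem feasible_mod_three (m s : ℕ) (hs : 5 ≤ s) (hm : 2 * s < m)
    (hmod : m % (2 * s) = 3) :
    ∃ G : Fin (3 * (m - 3) / (2 * s) + 3) → ZMod m → ZMod 2,
      IsDecentralizedCode m s G ∧ Correct m s G ∧ Secure m s G := by
  have hq : 1 ≤ m / (2 * s) := Nat.div_pos hm.le (by omega)
  have hdiv := Nat.div_add_mod m (2 * s)
  rw [hmod] at hdiv
  generalize m / (2 * s) = q at hq hdiv
  subst hdiv
  have hlen : 3 * (2 * s * q + 3 - 3) / (2 * s) = 3 * q := by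
    rw [Nat.add_sub_cancel, Nat.mul_left_comm, Nat.mul_div_cancel_left _ (by omega)]
  rcases hs.eq_or_lt with rfl | hs
  · obtain ⟨n, rfl⟩ := Nat.exists_eq_add_of_le' hq
    rw [show 2 * 5 * (n + 1) + 3 = 10 * n + 13 by ring] at hlen ⊢
    exact exists_code_five (by omega)
  · exact exists_code_of_six_le hs hq (by omega)
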